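/- arXiv:1709.06979 — 4 statements merged into one kernel-verified Lean document; each statement's English description precedes it below -/
import Mathlib

section
/- For every integer r ≥ 3, there exist infinitely many pairwise non-isomorphic connected r-regular permutation graphs. -/
def graphOfPerm {n : ℕ} (π : Equiv.Perm (Fin n)) : SimpleGraph (Fin n) :=
  SimpleGraph.fromRel (fun i j => i < j ∧ π j < π i)

def IsPermGraph {V : Type*} (G : SimpleGraph V) : Prop :=
  ∃ (n : ℕ) (π : Equiv.Perm (Fin n)), Nonempty (G ≃g graphOfPerm π)

/-- `G` is `r`-regular: every vertex has exactly `r` neighbors. -/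
def IsRegular' {V : Type*} (G : SimpleGraph V) (r : ℕ) : Prop :=
  ∀ v, (G.neighborSet v).ncard = r

theorem exists_equiv_fin_lt_iff_of_injective {V α : Type*} [Fintype V] [LinearOrder α]
    {f : V → α} (hf : Function.Injective f) :
    ∃ e : V ≃ Fin (Fintype.card V), ∀ x y, e x < e y ↔ f x < f y := by
  let _ : LinearOrder V := LinearOrder.lift' f hf
  exact ⟨(Fintype.orderIsoFinOfCardEq V rfl).symm.toEquiv,
    fun x y => (Fintype.orderIsoFinOfCardEq V rfl).symm.lt_iff_lt⟩

/-- A graph whose edges are the inversions between two linear orders is a permutation graph. -/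
theorem exists_iso_graphOfPerm {V α β : Type*} [Fintype V] [LinearOrder α] [LinearOrder β]
    (G : SimpleGraph V) {f : V → α} {g : V → β}
    (hf : Function.Injective f) (hg : Function.Injective g)
    (h : ∀ x y, G.Adj x y ↔ f x < f y ∧ g y < g x ∨ f y < f x ∧ g x < g y) :
    ∃ π : Equiv.Perm (Fin (Fintype.card V)), Nonempty (G ≃g graphOfPerm π) := by
  obtain ⟨e, he⟩ := exists_equiv_fin_lt_iff_of_injective hf
  obtain ⟨d, hd⟩ := exists_equiv_fin_lt_iff_of_injective hg
  refine ⟨e.symm.trans d, ⟨⟨e, fun {x y} => ?_⟩⟩⟩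
  simp only [graphOfPerm, SimpleGraph.fromRel_adj, Equiv.trans_apply, Equiv.symm_apply_apply,
    he, hd, h, ne_eq, e.injective.eq_iff, and_iff_right_iff_imp]
  rintro (hxy | hxy) rfl <;> exact lt_irrefl _ hxy.1

theorem IsRegular'.of_iso {V W : Type*} {G : SimpleGraph V} {H : SimpleGraph W} {r : ℕ}
    (hG : IsRegular' G r) (φ : G ≃g H) : IsRegular' H r := by
  intro w
  rw [← hG (φ.symm w), ← Set.ncard_image_of_injective _ φ.injective]
  congr 1
  ext v
  constructor
  · intro hv
    exact ⟨φ.symm v, φ.symm.map_rel_iff.2 hv, φ.apply_symm_apply v⟩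
  · rintro ⟨u, hu, rfl⟩
    simpa using φ.map_rel_iff.2 hu

/-- Sizes of the consecutive layers of the layered graph; layers outside `1, …, 4 * k + 2`
are empty. -/
def layerSize (r k i : ℕ) : ℕ :=
  if i = 0 ∨ 4 * k + 2 < i then 0
  else if i % 4 = 1 then 2
  else if i % 4 = 2 then r - 1
  else if i % 4 = 3 then r - 2
  else 1

abbrev LayerVertex (r k : ℕ) : Type := {p : ℕ × ℕ // p.2 < layerSize r k p.1}

/-- The path with `4 * k + 2` vertices, with its two ends replaced by cliques and its inner vertices
by independent sets. -/
def layerGraph (r k : ℕ) : SimpleGraph (LayerVertex r k) where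
  Adj x y := x.1.1 + 1 = y.1.1 ∨ y.1.1 + 1 = x.1.1 ∨
    x.1.1 = y.1.1 ∧ x.1.2 ≠ y.1.2 ∧ (x.1.1 = 1 ∨ x.1.1 = 4 * k + 2)
  symm := ⟨fun x y h => by grind⟩
  loopless := ⟨fun x h => by grind⟩

theorem layerSize_le {r : ℕ} (hr : 3 ≤ r) (k i : ℕ) : layerSize r k i ≤ r := by
  unfold layerSize
  grind

theorem layerSize_pos {r k i : ℕ} (hr : 3 ≤ r) (hi : 1 ≤ i) (hik : i ≤ 4 * k + 2) :
    0 < layerSize r k i := by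
  unfold layerSize
  grind

theorem mem_Icc_of_layerSize_pos {r k i : ℕ} (h : 0 < layerSize r k i) :
    1 ≤ i ∧ i ≤ 4 * k + 2 := by
  unfold layerSize at h
  grind

instance (r k : ℕ) : Finite (LayerVertex r k) := by
  refine Set.Finite.subset
    ((Set.finite_Iic (4 * k + 2)).prod (Set.finite_Iic (r + 2))) ?_ |>.to_subtype
  rintro ⟨i, t⟩ h
  change t < layerSize r k i at h
  simp only [layerSize, Set.mem_prod, Set.mem_Iic] at h ⊢
  grind

theorem layerGraph_isRegular {r : ℕ} (hr : 3 ≤ r) (k : ℕ) : IsRegular' (layerGraph r k) r := by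
  rintro ⟨⟨i, t⟩, ht⟩
  dsimp only at ht
  obtain ⟨hi, hik⟩ := mem_Icc_of_layerSize_pos (pos_of_gt ht)
  let C : Finset ℕ := if i = 1 ∨ i = 4 * k + 2 then (Finset.range (layerSize r k i)).erase t else ∅
  let s : ℕ → Finset ℕ := fun j => if j = i then C else Finset.range (layerSize r k j)
  have key : Subtype.val '' (layerGraph r k).neighborSet ⟨(i, t), ht⟩ =
      ((({i - 1, i, i + 1} : Finset ℕ).sigma s).image fun p => (p.1, p.2) : Finset (ℕ × ℕ)) := by
    ext ⟨j, u⟩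
    simp only [Set.mem_image, SimpleGraph.mem_neighborSet, layerGraph, Finset.coe_image,
      Finset.mem_coe, Finset.mem_sigma, Finset.mem_insert, Finset.mem_singleton, s, C,
      Subtype.exists, Sigma.exists, Prod.exists, Prod.mk.injEq]
    constructor
    · rintro ⟨j, u, hu, h, rfl, rfl⟩
      refine ⟨j, u, ?_, rfl, rfl⟩
      grind
    · rintro ⟨j, u, h, rfl, rfl⟩
      refine ⟨j, u, ?_, ?_, rfl, rfl⟩ <;> grind
  rw [← Set.ncard_image_of_injective _ Subtype.val_injective, key, Set.ncard_coe_finset,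
    Finset.card_image_of_injective _ (by rintro ⟨a, b⟩ ⟨c, d⟩ h; simp_all), Finset.card_sigma,
    Finset.sum_insert (by grind), Finset.sum_insert (by grind), Finset.sum_singleton]
  have h₁ : i - 1 ≠ i := by omega
  have hC : C.card = if i = 1 ∨ i = 4 * k + 2 then layerSize r k i - 1 else 0 := by
    simp only [C]
    split_ifs
    · rw [Finset.card_erase_of_mem (Finset.mem_range.2 ht), Finset.card_range]
    · rfl
  simp only [s, h₁, if_true, if_false, Nat.succ_ne_self, Nat.succ_ne_zero, false_or,
    Finset.card_range, hC, layerSize]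
  split_ifs <;> omega

theorem layerGraph_connected {r : ℕ} (hr : 3 ≤ r) (k : ℕ) : (layerGraph r k).Connected := by
  have h₁ : 0 < layerSize r k 1 := layerSize_pos hr le_rfl (by omega)
  have key : ∀ i t (h : t < layerSize r k i),
      (layerGraph r k).Reachable ⟨(1, 0), h₁⟩ ⟨(i, t), h⟩ := by
    intro i
    induction i with
    | zero => intro t h; simp [layerSize] at h
    | succ i ih =>
      intro t h
      obtain rfl | hi := Nat.eq_zero_or_pos i
      · obtain rfl | ht := Nat.eq_zero_or_pos t
        · exact SimpleGraph.Reachable.refl _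
        · apply SimpleGraph.Adj.reachable
          simp only [layerGraph]
          have := ht.ne
          simp [this]
      · have hik := (mem_Icc_of_layerSize_pos (pos_of_gt h)).2
        refine (ih 0 (layerSize_pos hr hi (by omega))).trans (SimpleGraph.Adj.reachable ?_)
        simp [layerGraph]
  rw [SimpleGraph.connected_iff_exists_forall_reachable]
  exact ⟨⟨(1, 0), h₁⟩, fun x => key x.1.1 x.1.2 x.2⟩

theorem layerGraph_exists_iso_graphOfPerm {r : ℕ} (hr : 3 ≤ r) (k : ℕ)
    [Fintype (LayerVertex r k)] :
    ∃ π : Equiv.Perm (Fin (Fintype.card (LayerVertex r k))),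
      Nonempty (layerGraph r k ≃g graphOfPerm π) := by
  let a : ℕ → ℕ := fun i => if i % 2 = 0 then i + 2 else i
  let b : ℕ → ℕ := fun i => if i % 2 = 0 then i else i + 2
  let c : ℕ → ℕ → ℕ := fun i t => if i = 1 ∨ i = 4 * k + 2 then r - t else t
  refine exists_iso_graphOfPerm (layerGraph r k)
    (f := fun x => toLex (a x.1.1, x.1.2)) (g := fun x => toLex (b x.1.1, c x.1.1 x.1.2))
    ?_ ?_ ?_
  · rintro ⟨⟨i, t⟩, h⟩ ⟨⟨j, u⟩, h'⟩ hij
    simp only [a, toLex_inj, Prod.mk.injEq, Subtype.mk.injEq] at hij ⊢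
    grind
  · rintro ⟨⟨i, t⟩, h⟩ ⟨⟨j, u⟩, h'⟩ hij
    have := layerSize_le hr k i
    have := layerSize_le hr k j
    simp only [b, c, toLex_inj, Prod.mk.injEq, Subtype.mk.injEq] at hij h h' ⊢
    grind
  · rintro ⟨⟨i, t⟩, h⟩ ⟨⟨j, u⟩, h'⟩
    have := layerSize_le hr k i
    have := layerSize_le hr k j
    simp only [layerGraph, a, b, c, Prod.Lex.toLex_lt_toLex] at h h' ⊢
    split_ifs <;> omega

theorem lt_card_layerVertex {r : ℕ} (hr : 3 ≤ r) (k : ℕ) [Fintype (LayerVertex r k)] :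
    k < Fintype.card (LayerVertex r k) := by
  have h := Fintype.card_le_of_injective
    (fun i : Fin (k + 1) => (⟨(i + 1, 0), layerSize_pos hr (by omega) (by omega)⟩ :
      LayerVertex r k)) (by intro i j h; simp at h; omega)
  simpa using h

/-- For every `r ≥ 3` there are infinitely many pairwise non-isomorphic connected
`r`-regular permutation graphs: the set of orders `m` for which a connected `r`-regular
permutation graph on `m` vertices exists is infinite. -/
theorem infinitely_many_regular_permutation_graphs (r : ℕ) (hr : 3 ≤ r) :
    {m : ℕ | ∃ G : SimpleGraph (Fin m),
      G.Connected ∧ IsRegular' G r ∧ IsPermGraph G}.Infinite := by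
  refine Set.infinite_of_forall_exists_gt fun k => ?_
  have := Fintype.ofFinite (LayerVertex r k)
  obtain ⟨π, ⟨φ⟩⟩ := layerGraph_exists_iso_graphOfPerm hr k
  exact ⟨_, ⟨graphOfPerm π, φ.connected_iff.1 (layerGraph_connected hr k),
    (layerGraph_isRegular hr k).of_iso φ, _, π, ⟨SimpleGraph.Iso.refl⟩⟩,
    lt_card_layerVertex hr k⟩
end

section
/- A 3-regular permutation graph cannot contain the ladder graph P_2 × P_4 (the Cartesian product of a path on 2 vertices with a path on 4 vertices) as a subgraph. -/
section

variable {V : Type*} {G : SimpleGraph V} {x y : V → ℕ}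

/-- Planar coordinates realizing `G` as a permutation graph: adjacency means that the two
coordinates order the endpoints oppositely. -/
structure IsPermModel (G : SimpleGraph V) (x y : V → ℕ) : Prop where
  injective_fst : Function.Injective x
  injective_snd : Function.Injective y
  adj_iff : ∀ u v, G.Adj u v ↔ (x u < x v ∧ y v < y u) ∨ (x v < x u ∧ y u < y v)

/-- Strict dominance order on both coordinates. -/
def Below (x y : V → ℕ) (u v : V) : Prop := x u < x v ∧ y u < y v

theorem Below.trans {u v w : V} (h : Below x y u v) (h' : Below x y v w) : Below x y u w :=
  ⟨h.1.trans h'.1, h.2.trans h'.2⟩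

theorem IsPermGraph.exists_isPermModel (h : IsPermGraph G) :
    ∃ x y : V → ℕ, IsPermModel G x y := by
  obtain ⟨n, π, ⟨e⟩⟩ := h
  refine ⟨fun v => (e v).val, fun v => (π (e v)).val, fun u v h => ?_, fun u v h => ?_,
    fun u v => ?_⟩
  · exact e.injective (Fin.ext h)
  · exact e.injective (π.injective (Fin.ext h))
  · rw [← e.map_adj_iff]
    unfold graphOfPerm
    rw [SimpleGraph.fromRel_adj]
    simp only [Fin.lt_def]
    constructor
    · rintro ⟨-, h⟩
      exact h
    · intro h
      refine ⟨fun h' => ?_, h⟩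
      rw [h'] at h
      omega

namespace IsPermModel

variable (hM : IsPermModel G x y)

include hM

theorem not_below {u v : V} (h : G.Adj u v) : ¬ Below x y u v := by
  rw [hM.adj_iff] at h
  unfold Below
  omega

theorem below_or {u v : V} (h : Gᶜ.Adj u v) : Below x y u v ∨ Below x y v u := by
  rw [SimpleGraph.compl_adj, hM.adj_iff] at h
  have h1 := hM.injective_fst.ne h.1
  have h2 := hM.injective_snd.ne h.1
  unfold Below
  omega

/-- If `u, w` are comparable and `v` is adjacent to `w` but not to `u`, then `u` lies on the same
side of `v` as of `w`. -/
theorem below_of_below {u v w : V} (h : Below x y u w) (hvw : G.Adj v w) (huv : Gᶜ.Adj u v) :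
    Below x y u v :=
  (hM.below_or huv).resolve_right fun h' => hM.not_below hvw (h'.trans h)

theorem below_of_below' {u v w : V} (h : Below x y w u) (hvw : G.Adj v w) (huv : Gᶜ.Adj u v) :
    Below x y v u :=
  (hM.below_or huv).resolve_left fun h' => hM.not_below hvw.symm (h.trans h')

/-- Edges at a common vertex with nonadjacent other ends are oriented alike. -/
theorem fst_lt_iff {u v w : V} (hv : G.Adj u v) (hw : G.Adj u w) (hvw : Gᶜ.Adj v w) :
    x u < x v ↔ x u < x w := by
  have := hM.below_or hvw
  rw [hM.adj_iff] at hv hw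
  unfold Below at this
  omega

theorem false_of_house {a b c a' b' e : V} (hab : G.Adj a b) (hac : G.Adj a c) (hbc : G.Adj b c)
    (haa : G.Adj a a') (hbb : G.Adj b b') (hce : G.Adj c e) (hba' : Gᶜ.Adj b a')
    (hab' : Gᶜ.Adj a b') (hca' : Gᶜ.Adj c a') (hcb' : Gᶜ.Adj c b') (hae : Gᶜ.Adj a e)
    (hbe : Gᶜ.Adj b e) : False := by
  have h1 := hM.fst_lt_iff hac haa hca'
  have h2 := hM.fst_lt_iff hbc hbb hcb'
  have h3 := hM.fst_lt_iff hac.symm hce hae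
  have h4 := hM.fst_lt_iff hbc.symm hce hbe
  have h5 := hM.fst_lt_iff hab haa hba'
  have h6 := hM.fst_lt_iff hab.symm hbb hab'
  have n1 := hM.injective_fst.ne hab.ne
  have n2 := hM.injective_fst.ne hac.ne
  have n3 := hM.injective_fst.ne hbc.ne
  omega

end IsPermModel

/-- The ladder with three rungs `a₁ b₁, a₂ b₂, a₃ b₃`, as an induced subgraph. -/
structure IsDomino (G : SimpleGraph V) (a₁ a₂ a₃ b₁ b₂ b₃ : V) : Prop where
  rung₁ : G.Adj a₁ b₁
  rung₂ : G.Adj a₂ b₂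
  rung₃ : G.Adj a₃ b₃
  a₁₂ : G.Adj a₁ a₂
  a₂₃ : G.Adj a₂ a₃
  b₁₂ : G.Adj b₁ b₂
  b₂₃ : G.Adj b₂ b₃
  a₁b₂ : Gᶜ.Adj a₁ b₂
  b₁a₂ : Gᶜ.Adj b₁ a₂
  a₂b₃ : Gᶜ.Adj a₂ b₃
  b₂a₃ : Gᶜ.Adj b₂ a₃
  a₁a₃ : Gᶜ.Adj a₁ a₃
  b₁b₃ : Gᶜ.Adj b₁ b₃
  a₁b₃ : Gᶜ.Adj a₁ b₃
  b₁a₃ : Gᶜ.Adj b₁ a₃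

namespace IsDomino

variable {a₁ a₂ a₃ b₁ b₂ b₃ : V}

theorem swap (h : IsDomino G a₁ a₂ a₃ b₁ b₂ b₃) : IsDomino G b₁ b₂ b₃ a₁ a₂ a₃ :=
  ⟨h.rung₁.symm, h.rung₂.symm, h.rung₃.symm, h.b₁₂, h.b₂₃, h.a₁₂, h.a₂₃, h.b₁a₂, h.a₁b₂,
    h.b₂a₃, h.a₂b₃, h.b₁b₃, h.a₁a₃, h.b₁a₃, h.a₁b₃⟩

theorem reverse (h : IsDomino G a₁ a₂ a₃ b₁ b₂ b₃) : IsDomino G a₃ a₂ a₁ b₃ b₂ b₁ :=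
  ⟨h.rung₃, h.rung₂, h.rung₁, h.a₂₃.symm, h.a₁₂.symm, h.b₂₃.symm, h.b₁₂.symm, h.b₂a₃.symm,
    h.a₂b₃.symm, h.b₁a₂.symm, h.a₁b₂.symm, h.a₁a₃.symm, h.b₁b₃.symm, h.b₁a₃.symm, h.a₁b₃.symm⟩

/-- The dominance order runs along a domino in one direction. -/
theorem below (hM : IsPermModel G x y) (h : IsDomino G a₁ a₂ a₃ b₁ b₂ b₃)
    (h₁ : Below x y a₁ b₂) : Below x y b₁ a₂ ∧ Below x y b₂ a₃ ∧ Below x y a₂ b₃ := by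
  have ha₁b₃ := hM.below_of_below h₁ h.b₂₃.symm h.a₁b₃
  have ha₁a₃ := hM.below_of_below ha₁b₃ h.rung₃ h.a₁a₃
  have hb₁a₃ := hM.below_of_below' ha₁a₃ h.rung₁.symm h.b₁a₃.symm
  have hb₁a₂ := hM.below_of_below hb₁a₃ h.a₂₃ h.b₁a₂
  have hb₂a₃ := hM.below_of_below' hb₁a₃ h.b₁₂.symm h.b₂a₃.symm
  have ha₂b₃ := hM.below_of_below' ha₁b₃ h.a₁₂.symm h.a₂b₃.symm
  exact ⟨hb₁a₂, hb₂a₃, ha₂b₃⟩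

theorem below_reverse (hM : IsPermModel G x y) (h : IsDomino G a₁ a₂ a₃ b₁ b₂ b₃)
    (h₁ : Below x y b₂ a₁) : Below x y b₃ a₂ :=
  hM.below_of_below (hM.below_of_below' h₁ h.b₂₃.symm h.a₁b₃) h.a₁₂.symm h.a₂b₃.symm

/-- A pendant neighbor of the first rung of an oriented domino precedes that rung. -/
theorem below_of_pendant (hM : IsPermModel G x y) (h : IsDomino G a₁ a₂ a₃ b₁ b₂ b₃)
    (h₁ : Below x y a₁ b₂) {d : V} (hd : G.Adj d b₁) (hd₁ : Gᶜ.Adj d a₁) (hd₂ : Gᶜ.Adj d a₂)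
    (hd₃ : Gᶜ.Adj d a₃) : Below x y d a₁ := by
  obtain ⟨hb₁a₂, -, ha₂b₃⟩ := h.below hM h₁
  have hb₁a₃ := hM.below_of_below (hb₁a₂.trans ha₂b₃) h.rung₃ h.b₁a₃
  have hda₃ := hM.below_of_below' hb₁a₃ hd hd₃.symm
  exact hM.below_of_below (hM.below_of_below hda₃ h.a₂₃ hd₂) h.a₁₂ hd₁

end IsDomino

theorem IsRegular'.exists_third (hreg : IsRegular' G 3) {v p q : V} (hp : G.Adj v p)
    (hq : G.Adj v q) (hpq : p ≠ q) :
    ∃ r, r ≠ p ∧ r ≠ q ∧ ∀ w, G.Adj v w ↔ w = p ∨ w = q ∨ w = r := by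
  have hv := hreg v
  have hfin : (G.neighborSet v).Finite := Set.finite_of_ncard_ne_zero (by omega)
  have hsub : ({p, q} : Set V) ⊆ G.neighborSet v := by
    rintro w (rfl | rfl) <;> assumption
  have hcard : (G.neighborSet v \ {p, q}).ncard = 1 := by
    rw [Set.ncard_sdiff hsub, Set.ncard_pair hpq, hv]
  obtain ⟨r, hr⟩ := Set.ncard_eq_one.mp hcard
  have hmem : ∀ w, (G.Adj v w ∧ ¬ (w = p ∨ w = q)) ↔ w = r := fun w => by
    simpa using Set.ext_iff.mp hr w
  have h' := (hmem r).mpr rfl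
  refine ⟨r, fun h => h'.2 (Or.inl h), fun h => h'.2 (Or.inr h), fun w => ⟨fun h => ?_, ?_⟩⟩
  · by_cases hw : w = p ∨ w = q
    · tauto
    · exact Or.inr (Or.inr ((hmem w).mp ⟨h, hw⟩))
  · rintro (rfl | rfl | rfl)
    exacts [hp, hq, h'.1]

theorem IsRegular'.eq_of_adj (hreg : IsRegular' G 3) {v p q r w : V} (hp : G.Adj v p)
    (hq : G.Adj v q) (hr : G.Adj v r) (hpq : p ≠ q) (hpr : p ≠ r) (hqr : q ≠ r)
    (hw : G.Adj v w) : w = p ∨ w = q ∨ w = r := by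
  obtain ⟨t, -, -, ht⟩ := hreg.exists_third hp hq hpq
  have := (ht r).mp hr
  have := (ht w).mp hw
  grind

/-- A not necessarily induced ladder with rungs `a i, b i`. -/
structure IsLadder (G : SimpleGraph V) (a b : Fin 4 → V) : Prop where
  injective_left : Function.Injective a
  injective_right : Function.Injective b
  ne : ∀ i j, a i ≠ b j
  rung : ∀ i, G.Adj (a i) (b i)
  left : ∀ i : Fin 3, G.Adj (a i.castSucc) (a i.succ)
  right : ∀ i : Fin 3, G.Adj (b i.castSucc) (b i.succ)

namespace IsLadder

variable {a b : Fin 4 → V}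

theorem swap (h : IsLadder G a b) : IsLadder G b a :=
  ⟨h.injective_right, h.injective_left, fun i j => (h.ne j i).symm, fun i => (h.rung i).symm,
    h.right, h.left⟩

theorem reverse (h : IsLadder G a b) : IsLadder G (a ∘ Fin.rev) (b ∘ Fin.rev) where
  injective_left := h.injective_left.comp Fin.rev_injective
  injective_right := h.injective_right.comp Fin.rev_injective
  ne _ _ := h.ne _ _
  rung _ := h.rung _
  left i := by
    simpa [Fin.rev_castSucc, Fin.rev_succ] using (h.left i.rev).symm
  right i := by
    simpa [Fin.rev_castSucc, Fin.rev_succ] using (h.right i.rev).symm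

theorem eq_of_adj_one (h : IsLadder G a b) (hreg : IsRegular' G 3) {w : V}
    (hw : G.Adj (a 1) w) : w = a 0 ∨ w = a 2 ∨ w = b 1 :=
  hreg.eq_of_adj (h.left 0).symm (h.left 1) (h.rung 1)
    (h.injective_left.ne (by decide)) (h.ne _ _) (h.ne _ _) hw

theorem compl_adj_one (h : IsLadder G a b) (hreg : IsRegular' G 3) {w : V} (hw : w ≠ a 1)
    (h0 : w ≠ a 0) (h2 : w ≠ a 2) (hb : w ≠ b 1) : Gᶜ.Adj w (a 1) := by
  refine ⟨hw, fun h' => ?_⟩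
  rcases h.eq_of_adj_one hreg h'.symm with h | h | h <;> contradiction

theorem compl_adj_two (h : IsLadder G a b) (hreg : IsRegular' G 3) {w : V} (hw : w ≠ a 2)
    (h3 : w ≠ a 3) (h1 : w ≠ a 1) (hb : w ≠ b 2) : Gᶜ.Adj w (a 2) :=
  h.reverse.compl_adj_one hreg hw h3 h1 hb

theorem isDomino (h : IsLadder G a b) (hreg : IsRegular' G 3) :
    IsDomino G (a 0) (a 1) (a 2) (b 0) (b 1) (b 2) := by
  have ha : ∀ {i j : Fin 4}, i ≠ j → a i ≠ a j := fun h' => h.injective_left.ne h'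
  have hb : ∀ {i j : Fin 4}, i ≠ j → b i ≠ b j := fun h' => h.injective_right.ne h'
  have hab := h.ne
  have hba : ∀ i j, b i ≠ a j := fun i j => (h.ne j i).symm
  exact
    { rung₁ := h.rung 0
      rung₂ := h.rung 1
      rung₃ := h.rung 2
      a₁₂ := h.left 0
      a₂₃ := h.left 1
      b₁₂ := h.right 0
      b₂₃ := h.right 1
      a₁b₂ := h.swap.compl_adj_one hreg (hab _ _) (hab _ _) (hab _ _) (ha (by decide))
      b₁a₂ := h.compl_adj_one hreg (hba _ _) (hba _ _) (hba _ _) (hb (by decide))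
      a₂b₃ := h.swap.compl_adj_two hreg (hab _ _) (hab _ _) (hab _ _) (ha (by decide))
      b₂a₃ := h.compl_adj_two hreg (hba _ _) (hba _ _) (hba _ _) (hb (by decide))
      a₁a₃ := h.compl_adj_two hreg (ha (by decide)) (ha (by decide)) (ha (by decide)) (hab _ _)
      b₁b₃ := h.swap.compl_adj_two hreg (hb (by decide)) (hb (by decide)) (hb (by decide))
        (hba _ _)
      a₁b₃ := h.swap.compl_adj_two hreg (hab _ _) (hab _ _) (hab _ _) (ha (by decide))
      b₁a₃ := h.compl_adj_two hreg (hba _ _) (hba _ _) (hba _ _) (hb (by decide)) }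

theorem isDomino' (h : IsLadder G a b) (hreg : IsRegular' G 3) :
    IsDomino G (a 1) (a 2) (a 3) (b 1) (b 2) (b 3) :=
  (h.reverse.isDomino hreg).reverse

/-- The neighbor of the first vertex of an oriented ladder outside its first square is outside
the ladder. -/
theorem notMem_of_adj_zero (hM : IsPermModel G x y) (hreg : IsRegular' G 3)
    (h : IsLadder G a b) (h0 : Below x y (a 0) (b 1)) {c : V} (hc : G.Adj (a 0) c)
    (hcb : c ≠ b 0) (hca : c ≠ a 1) : (∀ i, c ≠ a i) ∧ ∀ i, c ≠ b i := by
  have hD := h.isDomino hreg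
  have hD' := h.isDomino' hreg
  obtain ⟨-, h2, h3⟩ := hD.below hM h0
  obtain ⟨-, h5, h6⟩ := hD'.below hM h3
  constructor
  · intro i hi
    subst hi
    fin_cases i
    · exact hc.ne rfl
    · exact hca rfl
    · exact hD.a₁a₃.2 hc
    · refine hM.not_below hc ?_
      exact (hM.below_of_below h0 hD.b₂₃.symm hD.a₁b₃).trans h5
  · intro i hi
    subst hi
    fin_cases i
    · exact hcb rfl
    · exact hD.a₁b₂.2 hc
    · exact hD.a₁b₃.2 hc
    · exact hM.not_below hc ((h0.trans h2).trans h6)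

/-- An oriented ladder can be extended by one rung before its first one. -/
theorem exists_extension (hM : IsPermModel G x y) (hreg : IsRegular' G 3)
    (h : IsLadder G a b) (h0 : Below x y (a 0) (b 1)) :
    ∃ c d, IsLadder G ![c, a 0, a 1, a 2] ![d, b 0, b 1, b 2] ∧
      Below x y c (b 0) ∧ Below x y d (a 0) := by
  have hD := h.isDomino hreg
  have h1 := (hD.below hM h0).1
  obtain ⟨c, hcb, hca, hc⟩ := hreg.exists_third (h.rung 0) (h.left 0) (h.ne 1 0).symm
  obtain ⟨d, hda, hdb, hd⟩ := hreg.exists_third (h.rung 0).symm (h.right 0) (h.ne 0 1)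
  have hac : G.Adj (a 0) c := (hc c).mpr (by simp)
  have hbd : G.Adj (b 0) d := (hd d).mpr (by simp)
  obtain ⟨nca, ncb⟩ := h.notMem_of_adj_zero hM hreg h0 hac hcb hca
  obtain ⟨ndb, nda⟩ := h.swap.notMem_of_adj_zero hM hreg h1 hbd hda hdb
  have cc1 := h.compl_adj_one hreg (nca 1) (nca 0) (nca 2) (ncb 1)
  have cc1' := h.swap.compl_adj_one hreg (ncb 1) (ncb 0) (ncb 2) (nca 1)
  have cc2' := h.swap.compl_adj_two hreg (ncb 2) (ncb 3) (ncb 1) (nca 2)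
  have dd1 := h.compl_adj_one hreg (nda 1) (nda 0) (nda 2) (ndb 1)
  have dd2 := h.compl_adj_two hreg (nda 2) (nda 3) (nda 1) (ndb 2)
  have ncd : c ≠ d := by
    rintro rfl
    obtain ⟨e, hea, heb, he⟩ := hreg.exists_third hac.symm hbd.symm (h.ne 0 0)
    have hce : G.Adj c e := (he e).mpr (by simp)
    have hae : Gᶜ.Adj (a 0) e := by
      refine ⟨hea.symm, fun h' => ?_⟩
      rcases (hc e).mp h' with rfl | rfl | rfl
      exacts [heb rfl, cc1.2 hce, hce.ne rfl]
    have hbe : Gᶜ.Adj (b 0) e := by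
      refine ⟨heb.symm, fun h' => ?_⟩
      rcases (hd e).mp h' with rfl | rfl | rfl
      exacts [hea rfl, cc1'.2 hce, hce.ne rfl]
    exact hM.false_of_house (h.rung 0) hac hbd (h.left 0) (h.right 0) hce hD.b₁a₂ hD.a₁b₂
      cc1 cc1' hae hbe
  have hcb0 : Gᶜ.Adj c (b 0) := by
    refine ⟨hcb, fun h' => ?_⟩
    rcases (hd c).mp h'.symm with h' | h' | h'
    exacts [nca 0 h', ncb 1 h', ncd h']
  have hda0 : Gᶜ.Adj d (a 0) := by
    refine ⟨hda, fun h' => ?_⟩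
    rcases (hc d).mp h'.symm with h' | h' | h'
    exacts [ndb 0 h', nda 1 h', ncd h'.symm]
  have hcb := hD.swap.below_of_pendant hM h1 hac.symm hcb0 cc1' cc2'
  have hda := hD.below_of_pendant hM h0 hbd.symm hda0 dd1 dd2
  have hcd : G.Adj c d := by
    by_contra h'
    rcases hM.below_or ⟨ncd, h'⟩ with h' | h'
    · exact hM.not_below hac.symm (h'.trans hda)
    · exact hM.not_below hbd.symm (h'.trans hcb)
  have ha : ∀ {i j : Fin 4}, a i = a j ↔ i = j := h.injective_left.eq_iff
  have hb : ∀ {i j : Fin 4}, b i = b j ↔ i = j := h.injective_right.eq_iff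
  refine ⟨c, d, ⟨?_, ?_, ?_, ?_, ?_, ?_⟩, hcb, hda⟩
  · intro i j
    fin_cases i <;> fin_cases j <;> simp [nca, (nca _).symm, ha]
  · intro i j
    fin_cases i <;> fin_cases j <;> simp [ndb, (ndb _).symm, hb]
  · intro i j
    fin_cases i <;> fin_cases j <;> simp [ncb, (nda _).symm, ncd, h.ne]
  · intro i
    fin_cases i
    exacts [hcd, h.rung 0, h.rung 1, h.rung 2]
  · intro i
    fin_cases i
    exacts [hac.symm, h.left 0, h.left 1]
  · intro i
    fin_cases i
    exacts [hbd.symm, h.right 0, h.right 1]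

theorem false_of_below (hM : IsPermModel G x y) (hreg : IsRegular' G 3)
    (h : IsLadder G a b) (h0 : Below x y (a 0) (b 1)) : False := by
  induction hn : x (a 0) + x (b 0) using Nat.strong_induction_on generalizing a b with
  | _ n ih =>
    obtain ⟨c, d, h', hcb, hda⟩ := h.exists_extension hM hreg h0
    refine ih (x c + x d) ?_ h' hcb rfl
    have := hcb.1
    have := hda.1
    omega

theorem of_hom (f : (SimpleGraph.pathGraph 2 □ SimpleGraph.pathGraph 4) →g G)
    (hf : Function.Injective f) : IsLadder G (fun i => f (0, i)) (fun i => f (1, i)) where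
  injective_left i j h := by simpa using hf h
  injective_right i j h := by simpa using hf h
  ne i j h := by simpa using hf h
  rung i := f.map_adj (by simp [SimpleGraph.pathGraph_adj])
  left i := f.map_adj (by simp [SimpleGraph.pathGraph_adj])
  right i := f.map_adj (by simp [SimpleGraph.pathGraph_adj])

end IsLadder

end

/-- A 3-regular permutation graph cannot contain the ladder `P₂ □ P₄` (four rungs)
as a (not necessarily induced) subgraph, i.e. there is no injective graph
homomorphism from `P₂ □ P₄` into it. -/
theorem no_four_rung_ladder_subgraph {V : Type*} [Fintype V] (G : SimpleGraph V)
    (hreg : IsRegular' G 3) (hperm : IsPermGraph G) :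
    ¬ ∃ f : (SimpleGraph.pathGraph 2 □ SimpleGraph.pathGraph 4) →g G,
        Function.Injective f := by
  rintro ⟨f, hf⟩
  obtain ⟨x, y, hM⟩ := hperm.exists_isPermModel
  have h := IsLadder.of_hom f hf
  obtain h0 | h0 := hM.below_or (h.isDomino hreg).a₁b₂
  · exact h.false_of_below hM hreg h0
  · have h1 := (h.isDomino' hreg).below_reverse hM ((h.isDomino hreg).below_reverse hM h0)
    exact h.swap.reverse.false_of_below hM hreg h1
end

section
/- Every connected 3-regular permutation graph is a blow-up of a path graph. -/
def blowup {V : Type*} (G : SimpleGraph V) (k : V → ℕ) (b : V → Bool) :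
    SimpleGraph (Σ v, Fin (k v)) :=
  SimpleGraph.fromRel (fun x y =>
    (x.1 = y.1 ∧ b x.1 = true) ∨ (x.1 ≠ y.1 ∧ G.Adj x.1 y.1))

namespace SimpleGraph

/-- `G.Layered S T` says that `S` is a union of successive layers, the last of which is `T`, each
layer being a clique or an independent set, with consecutive layers completely joined and no other
edges between layers. -/
inductive Layered {V : Type*} (G : SimpleGraph V) : Set V → Set V → Prop
  | nil : Layered G ∅ ∅
  | cons {S T S' : Set V} (C : Set V) : Layered G S T → (∀ v, v ∈ S' ↔ v ∈ S ∨ v ∈ C) →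
      (∀ v ∈ C, v ∉ S) →
      ((∀ u ∈ C, ∀ v ∈ C, u ≠ v → G.Adj u v) ∨ (∀ u ∈ C, ∀ v ∈ C, ¬ G.Adj u v)) →
      (∀ u ∈ C, ∀ v ∈ S, G.Adj u v ↔ v ∈ T) → Layered G S' C

theorem Layered.exists_index {V : Type*} {G : SimpleGraph V} {S T : Set V}
    (h : G.Layered S T) :
    ∃ (m : ℕ) (f : V → ℕ) (b : ℕ → Bool), (∀ v ∈ S, f v < m) ∧
      (∀ v ∈ S, v ∈ T ↔ f v + 1 = m) ∧
      ∀ u ∈ S, ∀ v ∈ S, u ≠ v → (G.Adj u v ↔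
        (f u = f v ∧ b (f u) = true) ∨ f u + 1 = f v ∨ f v + 1 = f u) := by
  classical
  induction h with
  | nil => exact ⟨0, fun _ => 0, fun _ => true, by simp, by simp, by simp⟩
  | @cons S T S' C _ hS' hdisj hC hadj ih =>
    obtain ⟨m, f, b, hlt, hT, hf⟩ := ih
    refine ⟨m + 1, fun v => if v ∈ C then m else f v,
      fun i => if i = m then decide (∀ u ∈ C, ∀ v ∈ C, u ≠ v → G.Adj u v) else b i, ?_, ?_, ?_⟩
    · intro v hv
      have := hS' v
      have := hlt v
      grind
    · intro v hv
      have := hS' v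
      have := hlt v
      grind
    · intro u hu v hv huv
      rw [hS'] at hu hv
      by_cases huC : u ∈ C <;> by_cases hvC : v ∈ C
      · simp only [huC, hvC, if_true, true_and, decide_eq_true_eq]
        constructor
        · intro h
          rcases hC with hC | hC
          · exact Or.inl hC
          · exact absurd h (hC u huC v hvC)
        · rintro (h | h | h)
          · exact h u huC v hvC huv
          · omega
          · omega
      · have hvS : v ∈ S := by tauto
        have h1 := hlt v hvS
        have h2 := hT v hvS
        have h3 := hadj u huC v hvS
        simp only [huC, hvC, if_true, if_false]
        rw [h3, h2]
        omega
      · have huS : u ∈ S := by tauto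
        have h1 := hlt u huS
        have h2 := hT u huS
        have h3 := hadj v hvC u huS
        simp only [huC, hvC, if_true, if_false]
        rw [G.adj_comm, h3, h2]
        omega
      · have huS : u ∈ S := by tauto
        have hvS : v ∈ S := by tauto
        have h1 := hlt u huS
        simp only [huC, hvC, if_false, h1.ne]
        exact hf u huS v hvS huv

theorem Layered.exists_iso_blowup {V : Type*} [Fintype V] {G : SimpleGraph V} {T : Set V}
    (h : G.Layered Set.univ T) :
    ∃ (m : ℕ) (k : Fin m → ℕ) (b : Fin m → Bool),
      Nonempty (G ≃g blowup (pathGraph m) k b) := by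
  classical
  obtain ⟨m, f, b, hlt, -, hf⟩ := h.exists_index
  let g : V → Fin m := fun v => ⟨f v, hlt v trivial⟩
  let e : V ≃ Σ i, Fin (Fintype.card {v // g v = i}) :=
    (Equiv.sigmaFiberEquiv g).symm.trans (Equiv.sigmaCongrRight fun i => Fintype.equivFin _)
  have he : ∀ v, (e v).1 = g v := fun _ => rfl
  refine ⟨m, fun i => Fintype.card {v // g v = i}, fun i => b i, ⟨⟨e, ?_⟩⟩⟩
  intro u v
  by_cases huv : u = v
  · subst huv
    simp
  · simp only [blowup, fromRel_adj, he, pathGraph_adj, ne_eq, e.injective.eq_iff, huv,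
      not_false_eq_true, true_and]
    rw [hf u trivial v trivial huv]
    simp only [g, Fin.mk.injEq]
    grind

theorem Connected.eq_univ_of_closed {V : Type*} {G : SimpleGraph V} (h : G.Connected)
    {S : Set V} {a : V} (ha : a ∈ S) (hS : ∀ u ∈ S, ∀ v, G.Adj u v → v ∈ S) :
    S = Set.univ := by
  refine Set.eq_univ_of_forall fun v => ?_
  obtain ⟨w⟩ := h.preconnected a v
  induction w with
  | nil => exact ha
  | cons hadj _ ih => exact ih (hS _ ha _ hadj)

/-- `x` and `y` are the coordinates of a permutation diagram of the cubic graph `G`; the last four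
fields record what cubicity says about the inversions at a vertex. -/
structure CubicDiagram {V : Type*} (G : SimpleGraph V) (n : ℕ) (x y : V → ℕ) : Prop where
  x_inj : ∀ u v, x u = x v → u = v
  y_inj : ∀ u v, y u = y v → u = v
  x_lt : ∀ v, x v < n
  y_lt : ∀ v, y v < n
  x_surj : ∀ i < n, ∃ v, x v = i
  y_surj : ∀ i < n, ∃ v, y v = i
  adj : ∀ u v, G.Adj u v ↔ (x u < x v ∧ y v < y u) ∨ (x v < x u ∧ y u < y v)
  displacement : ∀ v, y v = x v + 3 ∨ y v = x v + 1 ∨ x v = y v + 1 ∨ x v = y v + 3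
  exists_left : ∀ v, y v = x v + 1 → ∃ u, x u < x v ∧ y v < y u
  exists_right : ∀ v, x v = y v + 1 → ∃ u, y u < y v ∧ x v < x u
  exists_two_left : ∀ v, x v = y v + 1 →
    ∃ u u', u ≠ u' ∧ x u < x v ∧ y v < y u ∧ x u' < x v ∧ y v < y u'
  exists_two_right : ∀ v, y v = x v + 1 →
    ∃ u u', u ≠ u' ∧ y u < y v ∧ x v < x u ∧ y u' < y v ∧ x v < x u'

namespace CubicDiagram

variable {V : Type*} {G : SimpleGraph V} {n : ℕ} {x y : V → ℕ}

theorem swap (h : CubicDiagram G n x y) : CubicDiagram G n y x where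
  x_inj := h.y_inj
  y_inj := h.x_inj
  x_lt := h.y_lt
  y_lt := h.x_lt
  x_surj := h.y_surj
  y_surj := h.x_surj
  adj u v := by rw [h.adj]; tauto
  displacement v := by have := h.displacement v; tauto
  exists_left := h.exists_right
  exists_right := h.exists_left
  exists_two_left := h.exists_two_right
  exists_two_right := h.exists_two_left

theorem iff_of_eq (h : CubicDiagram G n x y) {v : V} {i j : ℕ} (hx : x v = i) (hy : y v = j)
    (u : V) : x u = i ↔ y u = j :=
  ⟨fun hu => h.x_inj u v (hu.trans hx.symm) ▸ hy, fun hu => h.y_inj u v (hu.trans hy.symm) ▸ hx⟩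

/-- The diagram cut in front of abscissa `q + 3`: all vertices to the left lie below ordinate
`q + 2`, except for the vertex with coordinates `(q, q + 3)`. -/
structure Cut (n : ℕ) (x y : V → ℕ) (q : ℕ) : Prop where
  lt : q + 3 < n
  left : ∀ v, x v < q + 3 ↔ y v < q + 2 ∨ y v = q + 3
  last : ∀ v, x v = q ↔ y v = q + 3

theorem Cut.next {q : ℕ} (hc : Cut n x y q) (h : CubicDiagram G n x y) :
    q + 6 < n ∧ (∀ v, x v = q + 5 ↔ y v = q + 2) ∧ (∀ v, x v = q + 3 ↔ y v = q + 6) := by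
  obtain ⟨hqn, hcut, hq⟩ := hc
  obtain ⟨w, hw⟩ := h.y_surj (q + 2) (by omega)
  have hwx : x w = q + 5 := by
    have h1 := hcut w
    have h2 : x w ≠ q + 3 := by
      intro h2
      obtain ⟨a, b, hab, h3⟩ := h.exists_two_left w (by omega)
      have ha := hcut a
      have hb := hcut b
      exact hab (h.y_inj a b (by omega))
    have := h.displacement w
    omega
  have hwn := h.x_lt w
  have ew := h.iff_of_eq hwx hw
  obtain ⟨a, ha⟩ := h.x_surj (q + 3) (by omega)
  have hay : y a = q + 6 := by
    have h1 := hcut a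
    have h2 : y a ≠ q + 4 := by
      intro h2
      obtain ⟨b, hb⟩ := h.exists_left a (by omega)
      have := hcut b
      omega
    have := h.displacement a
    have := ew a
    omega
  exact ⟨hay ▸ h.y_lt a, ew, h.iff_of_eq ha hay⟩

theorem Cut.cases {q : ℕ} (hc : Cut n x y q) (h : CubicDiagram G n x y) :
    q + 7 < n ∧ (∀ v, x v = q + 7 ↔ y v = q + 4) ∧
    ((∀ v, x v = q + 4 ↔ y v = q + 5) ∨
      (∀ v, x v = q + 4 ↔ y v = q + 7) ∧
        ((∀ v, x v = q + 6 ↔ y v = q + 5) ∨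
          (∀ v, x v = q + 8 ↔ y v = q + 5) ∧ (∀ v, x v = q + 6 ↔ y v = q + 9) ∧ q + 9 < n)) := by
  obtain ⟨hn, ew, ea⟩ := hc.next h
  obtain ⟨-, hcut, hq⟩ := hc
  obtain ⟨b, hb⟩ := h.x_surj (q + 4) (by omega)
  obtain ⟨c, hc⟩ := h.y_surj (q + 4) (by omega)
  have hby : y b = q + 5 ∨ y b = q + 7 := by
    have := h.displacement b; have := hcut b; have := hq b
    omega
  have hcx : x c = q + 7 := by
    have eb := h.iff_of_eq hb rfl c
    have := h.displacement c; have := hcut c; have := ea c; have := ew c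
    omega
  have ec := h.iff_of_eq hcx hc
  have hcn := h.x_lt c
  refine ⟨by omega, ec, ?_⟩
  rcases hby with hby | hby
  · exact Or.inl (h.iff_of_eq hb hby)
  refine Or.inr ⟨h.iff_of_eq hb hby, ?_⟩
  have eb := h.iff_of_eq hb hby
  obtain ⟨d, hd⟩ := h.y_surj (q + 5) (by omega)
  have hdx : x d = q + 6 ∨ x d = q + 8 := by
    have := h.displacement d; have := hcut d; have := eb d
    omega
  rcases hdx with hdx | hdx
  · exact Or.inl (h.iff_of_eq hdx hd)
  · have ed := h.iff_of_eq hdx hd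
    obtain ⟨e, he⟩ := h.x_surj (q + 6) (by omega)
    have hey : y e = q + 9 := by
      have := h.displacement e; have := ed e; have := eb e; have := hq e
      omega
    exact Or.inr ⟨ed, h.iff_of_eq he hey, hey ▸ h.y_lt e⟩

theorem Cut.layered_next {q : ℕ} (hc : Cut n x y q) (h : CubicDiagram G n x y)
    (hL : G.Layered {v | x v < q + 3} {v | x v = q}) :
    G.Layered {v | x v < q + 3 ∨ x v = q + 5} {v | x v = q + 5} := by
  obtain ⟨-, ew, -⟩ := hc.next h
  refine hL.cons _ (fun v => Iff.rfl) ?_ (Or.inl ?_) ?_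
  · simp only [Set.mem_ofPred_eq]
    omega
  · intro v hv v' hv' hne
    exact absurd (h.x_inj v v' (hv.trans hv'.symm)) hne
  · intro v hv v' hv'
    simp only [Set.mem_ofPred_eq] at hv hv' ⊢
    rw [h.adj]
    have := hc.left v'; have := hc.last v'; have := ew v
    omega

theorem Cut.layered_pair {q : ℕ} (hc : Cut n x y q) (h : CubicDiagram G n x y)
    (hb : (∀ v, x v = q + 4 ↔ y v = q + 5) ∨ (∀ v, x v = q + 4 ↔ y v = q + 7))
    (hL : G.Layered {v | x v < q + 3} {v | x v = q}) :
    G.Layered {v | x v < q + 6} {v | x v = q + 3 ∨ x v = q + 4} := by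
  obtain ⟨-, ew, ea⟩ := hc.next h
  refine (hc.layered_next h hL).cons _ (fun v => ?_) ?_ ?_ ?_
  · simp only [Set.mem_ofPred_eq]; omega
  · simp only [Set.mem_ofPred_eq]; omega
  · refine hb.imp (fun eb => ?_) (fun eb => ?_) <;> intro v hv v' hv'
    · intro hne
      have := mt (h.x_inj v v') hne
      simp only [Set.mem_ofPred_eq] at hv hv'
      rw [h.adj]
      have := ea v; have := ea v'; have := eb v; have := eb v'
      omega
    · simp only [Set.mem_ofPred_eq] at hv hv'
      rw [h.adj]
      have := ea v; have := ea v'; have := eb v; have := eb v'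
      omega
  · intro v hv v' hv'
    simp only [Set.mem_ofPred_eq] at hv hv' ⊢
    rw [h.adj]
    have h1 := ea v
    have h2 : x v = q + 4 → y v = q + 5 ∨ y v = q + 7 := fun h2 =>
      hb.imp (fun eb => (eb v).1 h2) (fun eb => (eb v).1 h2)
    have := ew v'; have := hc.left v'
    omega

theorem Cut.step_clique {q : ℕ} (hc : Cut n x y q) (h : CubicDiagram G n x y)
    (eb : ∀ v, x v = q + 4 ↔ y v = q + 5)
    (hL : G.Layered {v | x v < q + 3} {v | x v = q}) :
    Cut n y x (q + 4) ∧ G.Layered {v | y v < q + 4 + 3} {v | y v = q + 4} := by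
  obtain ⟨-, ew, ea⟩ := hc.next h
  obtain ⟨hn, ec, -⟩ := hc.cases h
  have hleft : ∀ v, y v < q + 7 ↔ x v < q + 6 ∨ x v = q + 7 := fun v => by
    have := hc.left v; have := ea v; have := eb v; have := ew v; have := ec v
    omega
  refine ⟨⟨hn, hleft, fun v => (ec v).symm⟩, ?_⟩
  refine (hc.layered_pair h (Or.inl eb) hL).cons _ (fun v => ?_) ?_ (Or.inl ?_) ?_
  · simp only [Set.mem_ofPred_eq]
    rw [hleft, ec]
  · intro v
    simp only [Set.mem_ofPred_eq]
    have := ec v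
    omega
  · intro v hv v' hv' hne
    exact absurd (h.y_inj v v' (hv.trans hv'.symm)) hne
  · intro v hv v' hv'
    simp only [Set.mem_ofPred_eq] at hv hv' ⊢
    rw [h.adj]
    have := hc.left v'; have := ea v'; have := eb v'; have := ew v'; have := ec v
    omega

theorem Cut.step_indep {q : ℕ} (hc : Cut n x y q) (h : CubicDiagram G n x y)
    (eb : ∀ v, x v = q + 4 ↔ y v = q + 7) (ed : ∀ v, x v = q + 8 ↔ y v = q + 5)
    (ee : ∀ v, x v = q + 6 ↔ y v = q + 9) (hn : q + 9 < n)
    (hL : G.Layered {v | x v < q + 3} {v | x v = q}) :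
    Cut n x y (q + 6) ∧ G.Layered {v | x v < q + 6 + 3} {v | x v = q + 6} := by
  obtain ⟨-, ew, ea⟩ := hc.next h
  obtain ⟨-, ec, -⟩ := hc.cases h
  have hleft : ∀ v, x v < q + 9 ↔ y v < q + 8 ∨ y v = q + 9 := fun v => by
    have := hc.left v; have := ea v; have := eb v; have := ew v; have := ec v
    have := ed v; have := ee v
    omega
  refine ⟨⟨hn, hleft, ee⟩, ?_⟩
  have hL' : G.Layered {v | x v < q + 6 ∨ x v = q + 7 ∨ x v = q + 8}
      {v | x v = q + 7 ∨ x v = q + 8} := by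
    refine (hc.layered_pair h (Or.inr eb) hL).cons _ (fun v => Iff.rfl) ?_ (Or.inr ?_) ?_
    · simp only [Set.mem_ofPred_eq]
      omega
    · intro v hv v' hv'
      simp only [Set.mem_ofPred_eq] at hv hv'
      rw [h.adj]
      have := ec v; have := ed v; have := ec v'; have := ed v'
      omega
    · intro v hv v' hv'
      simp only [Set.mem_ofPred_eq] at hv hv' ⊢
      rw [h.adj]
      have := ec v; have := ed v
      have := hc.left v'; have := ea v'; have := eb v'; have := ew v'
      omega
  refine hL'.cons _ (fun v => ?_) ?_ (Or.inl ?_) ?_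
  · simp only [Set.mem_ofPred_eq]
    omega
  · simp only [Set.mem_ofPred_eq]
    omega
  · intro v hv v' hv' hne
    exact absurd (h.x_inj v v' (hv.trans hv'.symm)) hne
  · intro v hv v' hv'
    simp only [Set.mem_ofPred_eq] at hv hv' ⊢
    rw [h.adj]
    have := ee v
    have := hc.left v'; have := ea v'; have := eb v'; have := ew v'; have := ec v'; have := ed v'
    omega

theorem Cut.step_last {q : ℕ} (hc : Cut n x y q) (h : CubicDiagram G n x y)
    (eb : ∀ v, x v = q + 4 ↔ y v = q + 7) (ed : ∀ v, x v = q + 6 ↔ y v = q + 5)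
    (hL : G.Layered {v | x v < q + 3} {v | x v = q}) :
    (∀ v, x v < q + 8 ↔ y v < q + 8) ∧
      G.Layered {v | x v < q + 8} {v | x v = q + 6 ∨ x v = q + 7} := by
  obtain ⟨-, ew, ea⟩ := hc.next h
  obtain ⟨-, ec, -⟩ := hc.cases h
  refine ⟨fun v => ?_, ?_⟩
  · have := hc.left v; have := ea v; have := eb v; have := ew v; have := ec v
    have := ed v
    omega
  refine (hc.layered_pair h (Or.inr eb) hL).cons _ (fun v => ?_) ?_ (Or.inl ?_) ?_
  · simp only [Set.mem_ofPred_eq]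
    omega
  · simp only [Set.mem_ofPred_eq]
    omega
  · intro v hv v' hv' hne
    have := mt (h.x_inj v v') hne
    simp only [Set.mem_ofPred_eq] at hv hv'
    rw [h.adj]
    have := ec v; have := ed v; have := ec v'; have := ed v'
    omega
  · intro v hv v' hv'
    simp only [Set.mem_ofPred_eq] at hv hv' ⊢
    rw [h.adj]
    have := ec v; have := ed v
    have := hc.left v'; have := ea v'; have := eb v'; have := ew v'
    omega

theorem eq_univ_of_lt_iff (h : CubicDiagram G n x y) (hG : G.Connected) {i : ℕ} (hi : 0 < i)
    (hcut : ∀ v, x v < i ↔ y v < i) : {v | x v < i} = Set.univ := by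
  obtain ⟨v⟩ := hG.nonempty
  obtain ⟨a, ha⟩ := h.x_surj 0 (by have := h.x_lt v; omega)
  refine hG.eq_univ_of_closed (a := a) (lt_of_eq_of_lt ha hi) fun u hu v huv => ?_
  simp only [Set.mem_ofPred_eq] at hu ⊢
  rw [h.adj] at huv
  have := hcut u; have := hcut v
  omega

theorem Cut.exists_layered_univ (hG : G.Connected) {q : ℕ} (hc : Cut n x y q)
    (h : CubicDiagram G n x y) (hL : G.Layered {v | x v < q + 3} {v | x v = q}) :
    ∃ T, G.Layered Set.univ T := by
  induction hN : n - q using Nat.strong_induction_on generalizing x y q with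
  | _ N ih =>
  have hn := hc.lt
  obtain ⟨-, -, eb | ⟨eb, ed | ⟨ed, ee, hn'⟩⟩⟩ := hc.cases h
  · obtain ⟨hc', hL'⟩ := hc.step_clique h eb hL
    exact ih _ (by omega) hc' h.swap hL' rfl
  · obtain ⟨hcut, hL'⟩ := hc.step_last h eb ed hL
    rw [h.eq_univ_of_lt_iff hG (by omega) hcut] at hL'
    exact ⟨_, hL'⟩
  · obtain ⟨hc', hL'⟩ := hc.step_indep h eb ed ee hn' hL
    exact ih _ (by omega) hc' h hL' rfl

theorem zero_iff (h : CubicDiagram G n x y) (hn : 0 < n) : ∀ v, x v = 0 ↔ y v = 3 := by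
  obtain ⟨a, ha⟩ := h.x_surj 0 hn
  refine h.iff_of_eq ha ?_
  have : y a ≠ 1 := by
    intro h1
    obtain ⟨b, hb⟩ := h.exists_left a (by omega)
    omega
  have := h.displacement a
  omega

theorem exists_layered_univ_of_one_two (h : CubicDiagram G n x y) (hG : G.Connected)
    (hn : 3 < n) (h1 : ∀ v, x v = 1 ↔ y v = 2) : ∃ T, G.Layered Set.univ T := by
  have h0 := h.zero_iff (by omega)
  have h3 := h.swap.zero_iff (by omega)
  have hT : G.Layered {v | x v < 2} {v | x v < 2} := by
    refine Layered.nil.cons _ (by simp) (by simp) (Or.inl ?_) (by simp)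
    intro v hv v' hv' hne
    have := mt (h.x_inj v v') hne
    simp only [Set.mem_ofPred_eq] at hv hv'
    rw [h.adj]
    have := h0 v; have := h0 v'; have := h1 v; have := h1 v'
    omega
  obtain ⟨a, ha⟩ := h.y_surj 1 (by omega)
  have hax : x a = 2 ∨ x a = 4 := by
    have := h.displacement a; have := h0 a
    omega
  rcases hax with hax | hax
  · have ea := h.iff_of_eq hax ha
    have hcut : ∀ v, x v < 4 ↔ y v < 4 := fun v => by
      have := h0 v; have := h1 v; have := h3 v; have := ea v
      omega
    have hL : G.Layered {v | x v < 4} {v | x v < 4} := by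
      refine Layered.nil.cons _ (by simp) (by simp) (Or.inl ?_) (by simp)
      intro v hv v' hv' hne
      have := mt (h.x_inj v v') hne
      simp only [Set.mem_ofPred_eq] at hv hv'
      rw [h.adj]
      have := h0 v; have := h0 v'; have := h1 v; have := h1 v'
      have := h3 v; have := h3 v'; have := ea v; have := ea v'
      omega
    rw [h.eq_univ_of_lt_iff hG (by omega) hcut] at hL
    exact ⟨_, hL⟩
  · have ea := h.iff_of_eq hax ha
    obtain ⟨b, hb⟩ := h.x_surj 2 (by omega)
    have hby : y b = 5 := by
      have := h.displacement b; have := h0 b; have := ea b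
      omega
    have eb := h.iff_of_eq hb hby
    have hc : Cut n x y 2 := ⟨lt_of_eq_of_lt hby.symm (h.y_lt b), fun v => by
      have := h0 v; have := h1 v; have := h3 v; have := ea v; have := eb v
      omega, eb⟩
    have hL : G.Layered {v | x v < 2 ∨ x v = 3 ∨ x v = 4} {v | x v = 3 ∨ x v = 4} := by
      refine hT.cons _ (fun v => Iff.rfl) ?_ (Or.inr ?_) ?_
      · simp only [Set.mem_ofPred_eq]
        omega
      · intro v hv v' hv'
        simp only [Set.mem_ofPred_eq] at hv hv'
        rw [h.adj]
        have := h3 v; have := h3 v'; have := ea v; have := ea v'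
        omega
      · intro v hv v' hv'
        simp only [Set.mem_ofPred_eq] at hv hv' ⊢
        rw [h.adj]
        have := h3 v; have := ea v; have := h0 v'; have := h1 v'
        omega
    refine hc.exists_layered_univ hG h (hL.cons _ (fun v => ?_) ?_ (Or.inl ?_) ?_)
    · simp only [Set.mem_ofPred_eq]
      omega
    · simp only [Set.mem_ofPred_eq]
      omega
    · intro v hv v' hv' hne
      exact absurd (h.x_inj v v' (hv.trans hv'.symm)) hne
    · intro v hv v' hv'
      simp only [Set.mem_ofPred_eq] at hv hv' ⊢
      rw [h.adj]
      have := eb v; have := h0 v'; have := h1 v'; have := h3 v'; have := ea v'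
      omega

theorem exists_layered_univ (h : CubicDiagram G n x y) (hG : G.Connected) :
    ∃ T, G.Layered Set.univ T := by
  obtain ⟨v⟩ := hG.nonempty
  have hn : 0 < n := by have := h.x_lt v; omega
  have h0 := h.zero_iff hn
  have h3 := h.swap.zero_iff hn
  have hn : 3 < n := by
    obtain ⟨a, ha⟩ := h.x_surj 0 hn
    have := h.y_lt a; have := h0 a
    omega
  obtain ⟨a, ha⟩ := h.x_surj 1 (by omega)
  obtain ⟨b, hb⟩ := h.y_surj 1 (by omega)
  have hay : y a = 2 ∨ y a = 4 := by
    have := h.displacement a; have := h3 a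
    omega
  have hbx : x b = 2 ∨ x b = 4 := by
    have := h.displacement b; have := h0 b
    omega
  rcases hay with hay | hay
  · exact h.exists_layered_univ_of_one_two hG hn (h.iff_of_eq ha hay)
  rcases hbx with hbx | hbx
  · exact h.swap.exists_layered_univ_of_one_two hG hn (h.swap.iff_of_eq hb hbx)
  have ea := h.iff_of_eq ha hay
  have eb := h.iff_of_eq hbx hb
  have hn4 := h.x_lt b
  obtain ⟨c, hc⟩ := h.x_surj 2 (by omega)
  have hcy : y c = 5 := by
    have := h.displacement c; have := eb c; have := h0 c
    omega
  have ec := h.iff_of_eq hc hcy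
  obtain ⟨d, hd⟩ := h.y_surj 2 (by omega)
  have hdx : x d = 5 := by
    have := h.displacement d; have := ea d; have := h3 d
    omega
  have ed := h.iff_of_eq hdx hd
  have hL : G.Layered {v | x v < 3} {v | x v < 3} := by
    refine Layered.nil.cons _ (by simp) (by simp) (Or.inr ?_) (by simp)
    intro v hv v' hv'
    simp only [Set.mem_ofPred_eq] at hv hv'
    rw [h.adj]
    have := h0 v; have := h0 v'; have := ea v; have := ea v'; have := ec v; have := ec v'
    omega
  have hcut : ∀ v, x v < 6 ↔ y v < 6 := fun v => by
    have := h0 v; have := ea v; have := ec v; have := h3 v; have := eb v; have := ed v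
    omega
  have hL' : G.Layered {v | x v < 6} {v | 3 ≤ x v ∧ x v < 6} := by
    refine hL.cons _ (fun v => ?_) ?_ (Or.inr ?_) ?_
    · simp only [Set.mem_ofPred_eq]
      omega
    · simp only [Set.mem_ofPred_eq]
      omega
    · intro v hv v' hv'
      simp only [Set.mem_ofPred_eq] at hv hv'
      rw [h.adj]
      have := h3 v; have := h3 v'; have := eb v; have := eb v'; have := ed v; have := ed v'
      omega
    · intro v hv v' hv'
      simp only [Set.mem_ofPred_eq] at hv hv' ⊢
      rw [h.adj]
      have := h3 v; have := eb v; have := ed v; have := h0 v'; have := ea v'; have := ec v'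
      omega
  rw [h.eq_univ_of_lt_iff hG (by omega) hcut] at hL'
  exact ⟨_, hL'⟩

end CubicDiagram

theorem card_filter_val_lt {V : Type*} [Fintype V] {n : ℕ} (e : V ≃ Fin n) (v : V) :
    (Finset.univ.filter fun u => (e u : ℕ) < e v).card = e v := by
  rw [← Finset.card_map e.toEmbedding, Finset.map_filter, Finset.map_univ_equiv]
  rw [← Fin.card_Iio]
  congr 1
  ext
  simp

theorem exists_cubicDiagram {V : Type*} [Fintype V] {G : SimpleGraph V}
    (hreg : IsRegular' G 3) (hperm : IsPermGraph G) :
    ∃ (n : ℕ) (x y : V → ℕ), CubicDiagram G n x y := by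
  classical
  obtain ⟨n, π, ⟨e⟩⟩ := hperm
  let f : V ≃ Fin n := e.toEquiv
  let g : V ≃ Fin n := f.trans π
  let x : V → ℕ := fun v => f v
  let y : V → ℕ := fun v => g v
  have hx : ∀ u v, x u = x v → u = v := fun u v h => f.injective (Fin.ext h)
  have hy : ∀ u v, y u = y v → u = v := fun u v h => g.injective (Fin.ext h)
  have hadj : ∀ u v, G.Adj u v ↔ (x u < x v ∧ y v < y u) ∨ (x v < x u ∧ y u < y v) := by
    intro u v
    rw [← e.map_adj_iff]
    refine (fromRel_adj _ _ _).trans ⟨fun h => h.2, fun h => ⟨fun huv => ?_, h⟩⟩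
    obtain rfl := f.injective huv
    omega
  let L : V → Finset V := fun v => Finset.univ.filter fun u => x u < x v ∧ y v < y u
  let R : V → Finset V := fun v => Finset.univ.filter fun u => y u < y v ∧ x v < x u
  let A : V → Finset V := fun v => Finset.univ.filter fun u => x u < x v ∧ y u < y v
  have hL : ∀ v, (A v).card + (L v).card = x v := fun v => by
    refine (Finset.card_union_of_disjoint ?_).symm.trans (Eq.trans ?_ (card_filter_val_lt f v))
    · rw [Finset.disjoint_filter]
      omega
    · congr 1
      ext u
      have := hy u v
      simp only [A, L, Finset.mem_union, Finset.mem_filter, Finset.mem_univ, true_and]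
      change _ ↔ x u < x v
      grind
  have hR : ∀ v, (A v).card + (R v).card = y v := fun v => by
    refine (Finset.card_union_of_disjoint ?_).symm.trans (Eq.trans ?_ (card_filter_val_lt g v))
    · rw [Finset.disjoint_filter]
      omega
    · congr 1
      ext u
      have := hx u v
      simp only [A, R, Finset.mem_union, Finset.mem_filter, Finset.mem_univ, true_and]
      change _ ↔ y u < y v
      grind
  have hLR : ∀ v, (L v).card + (R v).card = 3 := fun v => by
    rw [← hreg v, ← Finset.card_union_of_disjoint, ← Set.ncard_coe_finset]
    · congr 1
      ext u
      simp only [L, R, Finset.coe_union, Finset.coe_filter, Set.mem_union, Finset.mem_univ,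
        true_and, Set.mem_ofPred_eq, mem_neighborSet, hadj]
      tauto
    · rw [Finset.disjoint_filter]
      omega
  refine ⟨n, x, y, hx, hy, fun v => (f v).2, fun v => (g v).2,
    fun i hi => ⟨f.symm ⟨i, hi⟩, by simp [x]⟩, fun i hi => ⟨g.symm ⟨i, hi⟩, by simp [y]⟩, hadj,
    fun v => ?_, fun v hv => ?_, fun v hv => ?_, fun v hv => ?_, fun v hv => ?_⟩ <;>
    have h1 := hL v <;> have h2 := hR v <;> have h3 := hLR v
  · omega
  · obtain ⟨u, hu⟩ := Finset.card_pos.1 (show 0 < (L v).card by omega)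
    exact ⟨u, by simpa [L] using hu⟩
  · obtain ⟨u, hu⟩ := Finset.card_pos.1 (show 0 < (R v).card by omega)
    exact ⟨u, by simpa [R] using hu⟩
  · obtain ⟨u, hu, u', hu', hne⟩ := Finset.one_lt_card.1 (show 1 < (L v).card by omega)
    simp only [L, Finset.mem_filter, Finset.mem_univ, true_and] at hu hu'
    exact ⟨u, u', hne, hu.1, hu.2, hu'⟩
  · obtain ⟨u, hu, u', hu', hne⟩ := Finset.one_lt_card.1 (show 1 < (R v).card by omega)
    simp only [R, Finset.mem_filter, Finset.mem_univ, true_and] at hu hu'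
    exact ⟨u, u', hne, hu.1, hu.2, hu'⟩

end SimpleGraph

/-- Every connected 3-regular permutation graph is a blow-up of a path graph. -/
theorem connected_cubic_permutation_graph_is_path_blowup {V : Type*} [Fintype V]
    (G : SimpleGraph V) (hconn : G.Connected) (hreg : IsRegular' G 3)
    (hperm : IsPermGraph G) :
    ∃ (m : ℕ) (k : Fin m → ℕ) (b : Fin m → Bool),
      Nonempty (G ≃g blowup (SimpleGraph.pathGraph m) k b) := by
  obtain ⟨n, x, y, h⟩ := SimpleGraph.exists_cubicDiagram hreg hperm
  obtain ⟨T, hT⟩ := h.exists_layered_univ hconn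
  exact hT.exists_iso_blowup
end

section
/- Every connected 3-regular permutation graph has a Hamiltonian path. -/
/-- A permutation of `{0, …, n - 1}`, given as a function on `ℕ`, that is indecomposable and whose
inversion graph is cubic, recorded through the displacements of its points. -/
structure CubicIndecomposable (n : ℕ) (f : ℕ → ℕ) : Prop where
  lt : ∀ i < n, f i < n
  inj : ∀ i < n, ∀ j < n, f i = f j → i = j
  surj : ∀ v < n, ∃ j < n, f j = v
  disp : ∀ i < n, f i = i + 3 ∨ (f i = i + 1 ∧ ∃ j < i, f i < f j) ∨
    (f i + 1 = i ∧ ∃ j < i, ∃ k < i, j ≠ k ∧ f i < f j ∧ f i < f k) ∨ f i + 3 = i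
  indec : ∀ k < n, 0 < k → ∃ j < k, k ≤ f j

/-- Adjacency in the inversion graph of `f` on `{0, …, n - 1}`. -/
def InvAdj (n : ℕ) (f : ℕ → ℕ) (a b : ℕ) : Prop :=
  a < n ∧ b < n ∧ ((a < b ∧ f b < f a) ∨ (b < a ∧ f a < f b))

/-- The points before `m + 2` take all values at most `m`, and `m + 3`, the latter at `m`. -/
structure EvenCut (n : ℕ) (f : ℕ → ℕ) (m : ℕ) : Prop where
  le : m + 2 ≤ n
  val : f m = m + 3
  low : ∀ j < m + 2, j ≠ m → f j ≤ m
  high : ∀ j < n, m + 2 ≤ j → m + 1 ≤ f j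

/-- The points before `m + 4` take all values at most `m + 1`, and `m + 3`, `m + 6`, the latter two
at `m` and `m + 3`. -/
structure OddCut (n : ℕ) (f : ℕ → ℕ) (m : ℕ) : Prop where
  le : m + 4 ≤ n
  val : f m = m + 3
  val' : f (m + 3) = m + 6
  low : ∀ j < m + 4, j ≠ m → j ≠ m + 3 → f j ≤ m + 1
  high : ∀ j < n, m + 4 ≤ j → m + 2 ≤ f j

namespace CubicIndecomposable

variable {n : ℕ} {f : ℕ → ℕ}

/-- The four possible positions of a value. -/
lemma preimage (h : CubicIndecomposable n f) {v : ℕ} (hv : v < n) :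
    ∃ j < n, f j = v ∧ (j + 3 = v ∨ j + 1 = v ∨ j = v + 1 ∨ j = v + 3) := by
  obtain ⟨j, hj, e⟩ := h.surj v hv
  refine ⟨j, hj, e, ?_⟩
  have := h.disp j hj
  omega

lemma evenCut_step (h : CubicIndecomposable n f) {m : ℕ} (s : EvenCut n f m) :
    m + 5 < n ∧ f (m + 2) = m + 5 ∧ f (m + 4) = m + 1 ∧
    ((f (m + 3) = m + 4 ∧ f (m + 5) = m + 2 ∧ n = m + 6) ∨
     (f (m + 3) = m + 2 ∧ OddCut n f (m + 2)) ∨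
     (f (m + 3) = m + 6 ∧ f (m + 5) = m + 2 ∧ f (m + 7) = m + 4 ∧ EvenCut n f (m + 6))) := by
  obtain ⟨hle, h0, hlow, hhigh⟩ := s
  have b0 := h.lt m (by omega)
  have h2 : f (m + 2) = m + 5 := by
    have := h.disp (m + 2) (by omega)
    have := hhigh (m + 2) (by omega) le_rfl
    have := h.inj m (by omega) (m + 2) (by omega)
    grind
  have b2 := h.lt (m + 2) (by omega)
  have h4 : f (m + 4) = m + 1 := by
    obtain ⟨j, hj, e, hh⟩ := h.preimage (v := m + 1) (by omega)
    have := hlow j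
    grind
  have c5 : m + 5 < n := by omega
  have h3 : f (m + 3) = m + 4 ∨ f (m + 3) = m + 2 ∨ f (m + 3) = m + 6 := by
    have := h.disp (m + 3) (by omega)
    have := h.inj m (by omega) (m + 3) (by omega)
    grind
  have b3 := h.lt (m + 3) (by omega)
  refine ⟨c5, h2, h4, ?_⟩
  rcases h3 with h3 | h3 | h3
  · have h5 : f (m + 5) = m + 2 := by
      obtain ⟨j, hj, e, hh⟩ := h.preimage (v := m + 2) (by omega)
      have := hlow j
      grind
    refine Or.inl ⟨h3, h5, ?_⟩
    by_contra hne
    obtain ⟨j, hj, hk⟩ := h.indec (m + 6) (by omega) (by omega)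
    have := hlow j
    grind
  · have h5 : f (m + 5) = m + 8 := by
      have := h.disp (m + 5) (by omega)
      have := h.inj (m + 5) (by omega) (m + 3) (by omega)
      grind
    refine Or.inr (Or.inl ⟨h3, ⟨by omega, h2, h5, ?_, ?_⟩⟩)
    · intro j hj _ _
      have := hlow j
      grind
    · intro j hj hj'
      have := hhigh j hj (by omega)
      have := h.inj j hj m (by omega)
      have := h.inj j hj (m + 4) (by omega)
      have := h.inj j hj (m + 3) (by omega)
      grind
  · have h5 : f (m + 5) = m + 2 := by
      obtain ⟨j, hj, e, hh⟩ := h.preimage (v := m + 2) (by omega)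
      have := hlow j
      grind
    have h6 : f (m + 6) = m + 9 := by
      have := h.disp (m + 6) (by omega)
      have := h.inj (m + 6) (by omega) (m + 2) (by omega)
      have := h.inj (m + 6) (by omega) (m + 0) (by omega)
      grind
    have b6 := h.lt (m + 6) (by omega)
    have h7 : f (m + 7) = m + 4 := by
      obtain ⟨j, hj, e, hh⟩ := h.preimage (v := m + 4) (by omega)
      have := hlow j
      grind
    refine Or.inr (Or.inr ⟨h3, h5, h7, ⟨by omega, h6, ?_, ?_⟩⟩)
    · intro j hj _
      have := hlow j
      grind
    · intro j hj hj'
      have := hhigh j hj (by omega)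
      have := h.inj j hj m (by omega)
      have := h.inj j hj (m + 2) (by omega)
      have := h.inj j hj (m + 3) (by omega)
      have := h.inj j hj (m + 4) (by omega)
      have := h.inj j hj (m + 5) (by omega)
      have := h.inj j hj (m + 7) (by omega)
      grind

lemma oddCut_step (h : CubicIndecomposable n f) {m : ℕ} (s : OddCut n f m) :
    m + 7 < n ∧ f (m + 5) = m + 2 ∧ f (m + 7) = m + 4 ∧
    ((f (m + 4) = m + 5 ∧ EvenCut n f (m + 6)) ∨
     (f (m + 4) = m + 7 ∧ f (m + 6) = m + 5 ∧ n = m + 8) ∨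
     (f (m + 4) = m + 7 ∧ f (m + 8) = m + 5 ∧ OddCut n f (m + 6))) := by
  obtain ⟨hle, h0, h1, hlow, hhigh⟩ := s
  have b1 := h.lt (m + 3) (by omega)
  have h5 : f (m + 5) = m + 2 := by
    obtain ⟨j, hj, e, hh⟩ := h.preimage (v := m + 2) (by omega)
    have := hlow j
    grind
  have h7 : f (m + 7) = m + 4 ∧ m + 7 < n := by
    obtain ⟨j, hj, e, hh⟩ := h.preimage (v := m + 4) (by omega)
    have := hlow j
    grind
  obtain ⟨h7, c7⟩ := h7
  have h4 : f (m + 4) = m + 5 ∨ f (m + 4) = m + 7 := by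
    have := h.disp (m + 4) (by omega)
    have := h.inj m (by omega) (m + 4) (by omega)
    have := hhigh (m + 4) (by omega) le_rfl
    grind
  refine ⟨c7, h5, h7, ?_⟩
  rcases h4 with h4 | h4
  · have h6 : f (m + 6) = m + 9 := by
      have := h.disp (m + 6) (by omega)
      have := h.inj (m + 6) (by omega) (m + 0) (by omega)
      have := h.inj (m + 6) (by omega) (m + 4) (by omega)
      grind
    refine Or.inl ⟨h4, ⟨by omega, h6, ?_, ?_⟩⟩
    · intro j hj _
      have := hlow j
      grind
    · intro j hj hj'
      have := hhigh j hj (by omega)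
      have := h.inj j hj m (by omega)
      have := h.inj j hj (m + 3) (by omega)
      have := h.inj j hj (m + 4) (by omega)
      have := h.inj j hj (m + 5) (by omega)
      have := h.inj j hj (m + 7) (by omega)
      grind
  · have h6 : f (m + 6) = m + 5 ∨ f (m + 6) = m + 9 := by
      have := h.disp (m + 6) (by omega)
      have := h.inj (m + 6) (by omega) (m + 0) (by omega)
      have := h.inj (m + 6) (by omega) (m + 4) (by omega)
      grind
    have b6 := h.lt (m + 6) (by omega)
    rcases h6 with h6 | h6
    · refine Or.inr (Or.inl ⟨h4, h6, ?_⟩)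
      by_contra hne
      obtain ⟨j, hj, hk⟩ := h.indec (m + 8) (by omega) (by omega)
      have := hlow j
      grind
    · have h8 : f (m + 8) = m + 5 := by
        obtain ⟨j, hj, e, hh⟩ := h.preimage (v := m + 5) (by omega)
        have := hlow j
        grind
      have h9 : f (m + 9) = m + 12 := by
        have := h.disp (m + 9) (by omega)
        have := h.inj (m + 9) (by omega) (m + 3) (by omega)
        grind (splits := 30)
      refine Or.inr (Or.inr ⟨h4, h8, ⟨by omega, h6, h9, ?_, ?_⟩⟩)
      · intro j hj _ _
        have := hlow j
        grind
      · intro j hj hj'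
        have := hhigh j hj (by omega)
        have := h.inj j hj m (by omega)
        have := h.inj j hj (m + 3) (by omega)
        have := h.inj j hj (m + 4) (by omega)
        have := h.inj j hj (m + 5) (by omega)
        have := h.inj j hj (m + 7) (by omega)
        have := h.inj j hj (m + 8) (by omega)
        grind

/-- From a cut at `m`, the remaining points can be traversed starting from a neighbour of `m`. -/
lemma exists_isChain_of_cut (h : CubicIndecomposable n f) (m : ℕ) :
    (EvenCut n f m → ∃ l : List ℕ, (m :: l).IsChain (InvAdj n f) ∧ l.Nodup ∧
      ∀ x, x ∈ l ↔ m + 2 ≤ x ∧ x < n) ∧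
    (OddCut n f m → ∃ l : List ℕ, (m :: l).IsChain (InvAdj n f) ∧ l.Nodup ∧
      ∀ x, x ∈ l ↔ m + 3 ≤ x ∧ x < n) := by
  induction hk : n - m using Nat.strong_induction_on generalizing m with
  | _ k ih =>
  subst hk
  constructor
  · intro s
    have h0 := s.val
    obtain ⟨c5, h2, h4, ⟨h3, h5, rfl⟩ | ⟨h3, s'⟩ | ⟨h3, h5, h7, s'⟩⟩ := h.evenCut_step s
    · refine ⟨[m + 4, m + 2, m + 3, m + 5], ?_, ?_, ?_⟩
      · simp [InvAdj, *]
      · simp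
      · intro x
        simp
        omega
    · obtain ⟨l, hl, hd, hm⟩ := (ih _ (by omega) (m + 2) rfl).2 s'
      refine ⟨(m + 3) :: (m + 4) :: (m + 2) :: l, ?_, ?_, ?_⟩
      · have := s'.le
        simp only [List.isChain_cons_cons, hl, and_true]
        simp only [InvAdj, h0, h2, h3, h4]
        omega
      · simp [hd, hm]
      · intro x
        simp [hm]
        omega
    · obtain ⟨l, hl, hd, hm⟩ := (ih _ (by omega) (m + 6) rfl).1 s'
      refine ⟨(m + 4) :: (m + 2) :: (m + 5) :: (m + 3) :: (m + 7) :: (m + 6) :: l, ?_, ?_, ?_⟩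
      · have := s'.le
        have := s'.val
        simp only [List.isChain_cons_cons, hl, and_true]
        simp only [InvAdj, h0, h2, h3, h4, h5, h7, this]
        omega
      · simp [hd, hm]
      · intro x
        have := s'.le
        simp [hm]
        omega
  · intro s
    have h0 := s.val
    have h1 := s.val'
    obtain ⟨c7, h5, h7, ⟨h4, s'⟩ | ⟨h4, h6, rfl⟩ | ⟨h4, h8, s'⟩⟩ := h.oddCut_step s
    · obtain ⟨l, hl, hd, hm⟩ := (ih _ (by omega) (m + 6) rfl).1 s'
      refine ⟨(m + 5) :: (m + 3) :: (m + 4) :: (m + 7) :: (m + 6) :: l, ?_, ?_, ?_⟩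
      · have := s'.val
        simp only [List.isChain_cons_cons, hl, and_true]
        simp only [InvAdj, h0, h1, h4, h5, h7, this]
        omega
      · simp [hd, hm]
      · intro x
        simp [hm]
        omega
    · refine ⟨[m + 5, m + 3, m + 6, m + 4, m + 7], ?_, ?_, ?_⟩
      · simp [InvAdj, *]
      · simp
      · intro x
        simp
        omega
    · obtain ⟨l, hl, hd, hm⟩ := (ih _ (by omega) (m + 6) rfl).2 s'
      refine ⟨(m + 5) :: (m + 3) :: (m + 7) :: (m + 4) :: (m + 8) :: (m + 6) :: l, ?_, ?_, ?_⟩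
      · have := s'.le
        have := s'.val
        simp only [List.isChain_cons_cons, hl, and_true]
        simp only [InvAdj, h0, h1, h4, h5, h7, h8, this]
        omega
      · simp [hd, hm]
      · intro x
        have := s'.le
        simp [hm]
        omega

lemma start (h : CubicIndecomposable n f) (hn : 0 < n) :
    f 0 = 3 ∧
    ((f 1 = 2 ∧ f 2 = 1 ∧ f 3 = 0 ∧ n = 4) ∨
     (f 1 = 4 ∧ f 2 = 5 ∧ f 3 = 0 ∧ f 4 = 1 ∧ f 5 = 2 ∧ n = 6) ∨
     (f 1 = 4 ∧ f 2 = 1 ∧ f 3 = 0 ∧ f 5 = 2 ∧ EvenCut n f 4) ∨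
     (f 1 = 2 ∧ f 3 = 0 ∧ f 4 = 1 ∧ OddCut n f 2)) := by
  have h0 : f 0 = 3 := by
    have := h.disp 0 hn
    grind
  have b0 := h.lt 0 hn
  refine ⟨h0, ?_⟩
  have h3 : f 3 = 0 := by
    obtain ⟨j, hj, e, hh⟩ := h.preimage (v := 0) hn
    have := h.disp 1 (by omega)
    grind
  have h1 : f 1 = 2 ∨ f 1 = 4 := by
    have := h.disp 1 (by omega)
    have := h.inj 1 (by omega) 3 (by omega)
    grind
  have h2 : f 2 = 1 ∨ f 2 = 5 := by
    have := h.disp 2 (by omega)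
    have := h.inj 2 (by omega) 0 (by omega)
    grind
  have b1 := h.lt 1 (by omega)
  have b2 := h.lt 2 (by omega)
  rcases h1 with h1 | h1 <;> rcases h2 with h2 | h2
  · refine Or.inl ⟨h1, h2, h3, ?_⟩
    by_contra hne
    obtain ⟨j, hj, hk⟩ := h.indec 4 (by omega) (by omega)
    interval_cases j <;> omega
  · have h4 : f 4 = 1 := by
      obtain ⟨j, hj, e, hh⟩ := h.preimage (v := 1) (by omega)
      grind
    have h5 : f 5 = 8 := by
      have := h.disp 5 (by omega)
      have := h.inj 5 (by omega) 1 (by omega)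
      grind
    refine Or.inr (Or.inr (Or.inr ⟨h1, h3, h4, ⟨by omega, h2, h5, ?_, ?_⟩⟩))
    · intro j hj _ _
      interval_cases j <;> omega
    · intro j hj hj'
      have := h.inj j hj 0 (by omega)
      have := h.inj j hj 1 (by omega)
      have := h.inj j hj 3 (by omega)
      have := h.inj j hj 4 (by omega)
      omega
  · have h5 : f 5 = 2 ∧ 5 < n := by
      obtain ⟨j, hj, e, hh⟩ := h.preimage (v := 2) (by omega)
      grind
    have h4 : f 4 = 7 := by
      have := h.disp 4 (by omega)
      have := h.inj 4 (by omega) 0 (by omega)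
      have := h.inj 4 (by omega) 2 (by omega)
      grind
    refine Or.inr (Or.inr (Or.inl ⟨h1, h2, h3, h5.1, ⟨by omega, h4, ?_, ?_⟩⟩))
    · intro j hj _
      interval_cases j <;> omega
    · intro j hj hj'
      have := h.inj j hj 0 (by omega)
      have := h.inj j hj 1 (by omega)
      have := h.inj j hj 2 (by omega)
      have := h.inj j hj 3 (by omega)
      have := h.inj j hj 5 (by omega)
      omega
  · have h4 : f 4 = 1 := by
      obtain ⟨j, hj, e, hh⟩ := h.preimage (v := 1) (by omega)
      grind
    have h5 : f 5 = 2 := by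
      obtain ⟨j, hj, e, hh⟩ := h.preimage (v := 2) (by omega)
      grind
    refine Or.inr (Or.inl ⟨h1, h2, h3, h4, h5, ?_⟩)
    by_contra hne
    obtain ⟨j, hj, hk⟩ := h.indec 6 (by omega) (by omega)
    interval_cases j <;> omega

lemma exists_isChain (h : CubicIndecomposable n f) (hn : 0 < n) :
    ∃ l : List ℕ, l.IsChain (InvAdj n f) ∧ l.Nodup ∧ ∀ x, x ∈ l ↔ x < n := by
  obtain ⟨h0, ⟨h1, h2, h3, rfl⟩ | ⟨h1, h2, h3, h4, h5, rfl⟩ | ⟨h1, h2, h3, h5, s⟩ |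
    ⟨h1, h3, h4, s⟩⟩ := h.start hn
  · refine ⟨[0, 1, 2, 3], ?_, ?_, ?_⟩
    · simp [InvAdj, *]
    · simp
    · intro x
      simp
      omega
  · refine ⟨[0, 3, 1, 4, 2, 5], ?_, ?_, ?_⟩
    · simp [InvAdj, *]
    · simp
    · intro x
      simp
      omega
  · obtain ⟨l, hl, hd, hm⟩ := (h.exists_isChain_of_cut 4).1 s
    have := s.le
    refine ⟨0 :: 2 :: 3 :: 1 :: 5 :: 4 :: l, ?_, ?_, ?_⟩
    · have := s.val
      simp only [List.isChain_cons_cons, hl, and_true]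
      simp only [InvAdj, h0, h1, h2, h3, h5, this]
      omega
    · simp [hd, hm]
    · intro x
      simp [hm]
      omega
  · obtain ⟨l, hl, hd, hm⟩ := (h.exists_isChain_of_cut 2).2 s
    have := s.le
    refine ⟨0 :: 3 :: 1 :: 4 :: 2 :: l, ?_, ?_, ?_⟩
    · have := s.val
      simp only [List.isChain_cons_cons, hl, and_true]
      simp only [InvAdj, h0, h1, h3, h4, this]
      omega
    · simp [hd, hm]
    · intro x
      simp [hm]
      omega

end CubicIndecomposable

/-- A permutation of `Fin n`, extended to `ℕ` by zero. -/
def permNat {n : ℕ} (π : Equiv.Perm (Fin n)) (i : ℕ) : ℕ :=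
  if h : i < n then π ⟨i, h⟩ else 0

lemma permNat_val {n : ℕ} (π : Equiv.Perm (Fin n)) (i : Fin n) : permNat π i = π i := by
  simp [permNat]

lemma graphOfPerm_adj {n : ℕ} (π : Equiv.Perm (Fin n)) (i j : Fin n) :
    (graphOfPerm π).Adj i j ↔ (i < j ∧ π j < π i) ∨ (j < i ∧ π i < π j) := by
  simp only [graphOfPerm, SimpleGraph.fromRel_adj]
  constructor
  · exact And.right
  · rintro (h | h)
    · exact ⟨h.1.ne, Or.inl h⟩
    · exact ⟨h.1.ne', Or.inr h⟩

/-- The displacement of a point is the number of inversions with larger points minus the number of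
inversions with smaller points. -/
lemma add_card_inversions {n : ℕ} (π : Equiv.Perm (Fin n)) (i : Fin n) :
    (i : ℕ) + (Finset.univ.filter fun j => i < j ∧ π j < π i).card =
      π i + (Finset.univ.filter fun j => j < i ∧ π i < π j).card := by
  have h1 : (Finset.univ.filter fun j => j < i ∧ π j < π i).card +
      (Finset.univ.filter fun j => j < i ∧ π i < π j).card = i := by
    rw [← Finset.card_union_of_disjoint
      (Finset.disjoint_left.2 fun j => by simp; omega)]
    conv_rhs => rw [← Fin.card_Iio i]
    congr 1
    ext j
    have := π.injective.ne_iff (x := i) (y := j)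
    simp only [Finset.mem_union, Finset.mem_filter, Finset.mem_univ, true_and, Finset.mem_Iio]
    omega
  have h2 : (Finset.univ.filter fun j => j < i ∧ π j < π i).card +
      (Finset.univ.filter fun j => i < j ∧ π j < π i).card = π i := by
    rw [← Finset.card_union_of_disjoint
      (Finset.disjoint_left.2 fun j => by simp; omega)]
    conv_rhs => rw [← Fin.card_Iio (π i), ← Finset.card_map π.symm.toEmbedding]
    congr 1
    ext j
    have := π.injective.ne_iff (x := i) (y := j)
    simp only [Finset.mem_union, Finset.mem_filter, Finset.mem_univ, true_and, Finset.mem_map_equiv,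
      Equiv.symm_symm, Finset.mem_Iio]
    omega
  omega

lemma card_inversions_of_isRegular {n : ℕ} {π : Equiv.Perm (Fin n)} {r : ℕ}
    (hreg : IsRegular' (graphOfPerm π) r) (i : Fin n) :
    (Finset.univ.filter fun j => i < j ∧ π j < π i).card +
      (Finset.univ.filter fun j => j < i ∧ π i < π j).card = r := by
  rw [← hreg i, ← Finset.card_union_of_disjoint
    (Finset.disjoint_left.2 fun j => by simp; omega), ← Set.ncard_coe_finset]
  congr 1
  ext j
  simp [graphOfPerm_adj]

lemma exists_le_of_connected {n : ℕ} {π : Equiv.Perm (Fin n)} (hconn : (graphOfPerm π).Connected)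
    {k : ℕ} (hk : k < n) (h0 : 0 < k) : ∃ j : Fin n, (j : ℕ) < k ∧ k ≤ π j := by
  by_contra! hlt
  have hiff (j : Fin n) : (π j : ℕ) < k ↔ (j : ℕ) < k := by
    let s : Finset (Fin n) := Finset.univ.filter fun j => (j : ℕ) < k
    have hs : s.map π.toEmbedding = s := by
      refine Finset.eq_of_subset_of_card_le ?_ (by simp)
      intro x hx
      obtain ⟨y, hy, rfl⟩ := Finset.mem_map.1 hx
      simpa [s] using hlt y (by simpa [s] using hy)
    have := Finset.mem_map' π.toEmbedding (a := j) (s := s)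
    rw [hs] at this
    simpa [s] using this
  have hwalk (u v : Fin n) (p : (graphOfPerm π).Walk u v) : (u : ℕ) < k → (v : ℕ) < k := by
    induction p with
    | nil => exact id
    | @cons u v w huv _ ih =>
      intro hu
      refine ih ?_
      have h1 := hiff u
      have h2 := hiff v
      rw [graphOfPerm_adj] at huv
      omega
  obtain ⟨p⟩ := hconn.preconnected ⟨0, by omega⟩ ⟨k, hk⟩
  exact absurd (hwalk _ _ p h0) (lt_irrefl k)

lemma cubicIndecomposable_permNat {n : ℕ} {π : Equiv.Perm (Fin n)}
    (hconn : (graphOfPerm π).Connected) (hreg : IsRegular' (graphOfPerm π) 3) :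
    CubicIndecomposable n (permNat π) where
  lt i hi := by simp [permNat, hi]
  inj i hi j hj h := by
    have : π ⟨i, hi⟩ = π ⟨j, hj⟩ := by
      ext
      simpa [permNat, hi, hj] using h
    simpa using this
  surj v hv := by
    refine ⟨π.symm ⟨v, hv⟩, Fin.is_lt _, ?_⟩
    rw [permNat_val, Equiv.apply_symm_apply]
  disp i hi := by
    lift i to Fin n using hi
    have h1 := add_card_inversions π i
    have h2 := card_inversions_of_isRegular hreg i
    rw [permNat_val]
    by_cases hA : (Finset.univ.filter fun j => j < i ∧ π i < π j).card = 1
    · refine Or.inr (Or.inl ⟨by omega, ?_⟩)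
      obtain ⟨j, hj⟩ := Finset.card_pos.1 (by omega :
        0 < (Finset.univ.filter fun j => j < i ∧ π i < π j).card)
      simp only [Finset.mem_filter, Finset.mem_univ, true_and] at hj
      exact ⟨j, hj.1, by rw [permNat_val]; exact hj.2⟩
    by_cases hB : (Finset.univ.filter fun j => j < i ∧ π i < π j).card = 2
    · refine Or.inr (Or.inr (Or.inl ⟨by omega, ?_⟩))
      obtain ⟨j, hj, k, hk, hjk⟩ := Finset.one_lt_card.1 (by omega :
        1 < (Finset.univ.filter fun j => j < i ∧ π i < π j).card)
      simp only [Finset.mem_filter, Finset.mem_univ, true_and] at hj hk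
      exact ⟨j, hj.1, k, hk.1, Fin.val_ne_of_ne hjk, by rw [permNat_val]; exact hj.2,
        by rw [permNat_val]; exact hk.2⟩
    omega
  indec k hk h0 := by
    obtain ⟨j, hj, hj'⟩ := exists_le_of_connected hconn hk h0
    exact ⟨j, hj, by rwa [permNat_val]⟩

lemma InvAdj.graphOfPerm_adj {n : ℕ} {π : Equiv.Perm (Fin n)} {a b : ℕ}
    (h : InvAdj n (permNat π) a b) : (graphOfPerm π).Adj ⟨a, h.1⟩ ⟨b, h.2.1⟩ := by
  obtain ⟨ha, hb, h⟩ := h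
  rw [_root_.graphOfPerm_adj]
  simpa [permNat, ha, hb] using h

lemma exists_isHamiltonian_of_isChain {V : Type*} [DecidableEq V] (G : SimpleGraph V) {l : List V}
    (hne : l ≠ []) (hl : l.IsChain G.Adj) (hd : l.Nodup) (hm : ∀ x, x ∈ l) :
    ∃ (u v : V) (p : G.Walk u v), p.IsHamiltonian :=
  ⟨_, _, SimpleGraph.Walk.ofSupport l hne hl, fun x => by
    rw [SimpleGraph.Walk.support_ofSupport]
    exact List.count_eq_one_of_mem hd (hm x)⟩

/-- Every connected 3-regular permutation graph has a Hamiltonian path. -/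
theorem cubic_permutation_graph_hamiltonian_path {V : Type*} [Fintype V] [DecidableEq V]
    (G : SimpleGraph V) (hconn : G.Connected) (hreg : IsRegular' G 3)
    (hperm : IsPermGraph G) :
    ∃ (u v : V) (p : G.Walk u v), p.IsHamiltonian := by
  obtain ⟨n, π, ⟨e⟩⟩ := hperm
  have hconn' : (graphOfPerm π).Connected := e.connected_iff.1 hconn
  have hreg' : IsRegular' (graphOfPerm π) 3 := by
    intro i
    rw [← hreg (e.symm i), ← Nat.card_coe_set_eq, ← Nat.card_coe_set_eq]
    exact Nat.card_congr (e.symm.mapNeighborSet i)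
  obtain ⟨i₀⟩ := hconn'.nonempty
  obtain ⟨l, hl, hd, hm⟩ :=
    (cubicIndecomposable_permNat hconn' hreg').exists_isChain (Nat.zero_lt_of_lt i₀.2)
  let g : ℕ → V := fun i => if h : i < n then e.symm ⟨i, h⟩ else e.symm i₀
  have hg (i : Fin n) : g i = e.symm i := by simp [g]
  refine exists_isHamiltonian_of_isChain G (l := l.map g) ?_ ?_ ?_ ?_
  · rw [Ne, List.map_eq_nil_iff]
    exact List.ne_nil_of_mem ((hm i₀).2 i₀.2)
  · refine List.isChain_map_of_isChain g ?_ hl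
    intro a b hab
    have := e.symm.map_adj_iff.2 hab.graphOfPerm_adj
    rwa [← hg, ← hg] at this
  · refine (List.nodup_map_iff_inj_on hd).2 ?_
    intro a ha b hb hab
    have ha' := (hm a).1 ha
    have hb' := (hm b).1 hb
    simpa [g, ha', hb'] using hab
  · intro x
    refine List.mem_map.2 ⟨e x, (hm _).2 (e x).2, ?_⟩
    rw [hg, RelIso.symm_apply_apply]
end
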